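/- For any (E, {f_i}_{i=1}^m) ∈ 𝓔, either U_{ℵ₀}(E) is countably infinite or U_{ℵ₀}(E) = ∅. -/

import Mathlib

open Set Filter MeasureTheory

/-- A self-similar iterated function system on `ℝ` given by `m` similitudes
`f i x = r i * x + t i` (for `1 ≤ i ≤ m`, `m ≥ 3`), together with its attractor `E`:
the unique nonempty compact set with `E = ⋃_{i=1}^m f_i(E)`. -/
structure ClassE where
  m : ℕ
  r : ℕ → ℝ
  t : ℕ → ℝ
  E : Set ℝ
  hm : 3 ≤ m
  hr : ∀ i, 1 ≤ i → i ≤ m → 0 < r i ∧ r i < 1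
  hEne : E.Nonempty
  hEcpt : IsCompact E
  hEinv : E = ⋃ i ∈ Finset.Icc 1 m, (fun x => r i * x + t i) '' E

namespace ClassE

/-- The `i`-th similitude. -/
def f (S : ClassE) (i : ℕ) (x : ℝ) : ℝ := S.r i * x + S.t i

/-- Left endpoint `a` of the convex hull of `E`. -/
noncomputable def a (S : ClassE) : ℝ := sInf S.E

/-- Right endpoint `b` of the convex hull of `E`. -/
noncomputable def b (S : ClassE) : ℝ := sSup S.E

/-- The convex hull `I = [a, b]` of `E`. -/
noncomputable def I (S : ClassE) : Set ℝ := Set.Icc S.a S.b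

/-- Condition (A): `a = f_1(a) < f_2(a) < ⋯ < f_m(a) < f_m(b) = b`. -/
def condA (S : ClassE) : Prop :=
  S.f 1 S.a = S.a ∧ (∀ i, 1 ≤ i → i < S.m → S.f i S.a < S.f (i + 1) S.a) ∧
    S.f S.m S.a < S.f S.m S.b ∧ S.f S.m S.b = S.b

/-- Condition (B): `f_i(I) ∩ f_{i+2}(I) = ∅` for all `1 ≤ i ≤ m - 2`. -/
def condB (S : ClassE) : Prop :=
  ∀ i, 1 ≤ i → i + 2 ≤ S.m → S.f i '' S.I ∩ S.f (i + 2) '' S.I = ∅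

/-- Condition (C): there are `i, j ∈ {1, …, m-1}` with `f_i(I) ∩ f_{i+1}(I) = ∅` and
`f_j(I) ∩ f_{j+1}(I) ≠ ∅`. -/
def condC (S : ClassE) : Prop :=
  (∃ i, 1 ≤ i ∧ i + 1 ≤ S.m ∧ S.f i '' S.I ∩ S.f (i + 1) '' S.I = ∅) ∧
    (∃ j, 1 ≤ j ∧ j + 1 ≤ S.m ∧ S.f j '' S.I ∩ S.f (j + 1) '' S.I ≠ ∅)

/-- Condition (D): whenever `f_i(I) ∩ f_{i+1}(I) ≠ ∅` there are `u, v ≥ 1` with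
`f_i(I) ∩ f_{i+1}(I) = f_i ∘ f_m^u (I) = f_{i+1} ∘ f_1^v (I)`. -/
def condD (S : ClassE) : Prop :=
  ∀ i, 1 ≤ i → i + 1 ≤ S.m → S.f i '' S.I ∩ S.f (i + 1) '' S.I ≠ ∅ →
    ∃ u v : ℕ, 1 ≤ u ∧ 1 ≤ v ∧
      S.f i '' S.I ∩ S.f (i + 1) '' S.I = (S.f i ∘ (S.f S.m)^[u]) '' S.I ∧
      S.f i '' S.I ∩ S.f (i + 1) '' S.I = (S.f (i + 1) ∘ (S.f 1)^[v]) '' S.I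

/-- Membership in the class `𝓔`: conditions (A)–(D). -/
def goodE (S : ClassE) : Prop := S.condA ∧ S.condB ∧ S.condC ∧ S.condD

/-- `prefixMap d n = f_{d 0} ∘ f_{d 1} ∘ ⋯ ∘ f_{d (n-1)}`. -/
def prefixMap (S : ClassE) (d : ℕ → ℕ) : ℕ → ℝ → ℝ
  | 0 => id
  | n + 1 => S.prefixMap d n ∘ S.f (d n)

/-- `d : ℕ → ℕ` (with digits in `{1, …, m}`) is a coding of `x` if
`x = lim_n f_{d 0} ∘ ⋯ ∘ f_{d (n-1)} (0)`. -/
def isCoding (S : ClassE) (d : ℕ → ℕ) (x : ℝ) : Prop :=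
  (∀ n, 1 ≤ d n ∧ d n ≤ S.m) ∧
    Tendsto (fun n => S.prefixMap d n 0) atTop (nhds x)

/-- The set of codings of `x`. -/
def codings (S : ClassE) (x : ℝ) : Set (ℕ → ℕ) := {d | S.isCoding d x}

/-- `U k E`: the set of points of `E` having exactly `k` distinct codings
(`k` a cardinal; e.g. `k = ℵ₀` for countably infinitely many codings,
`k = 𝔠 = 2^ℵ₀` for a continuum of codings). -/
def U (S : ClassE) (k : Cardinal) : Set ℝ :=
  {x ∈ S.E | Cardinal.mk (S.codings x) = k}

end ClassE

open ClassE

namespace ClassE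

variable {S : ClassE}

def In (S : ClassE) (i : ℕ) : Prop := 1 ≤ i ∧ i ≤ S.m

lemma f_strictMono {i : ℕ} (hi : S.In i) : StrictMono (S.f i) := by
  intro x y h
  have := (S.hr i hi.1 hi.2).1
  unfold f
  nlinarith

lemma f_inj {i : ℕ} (hi : S.In i) : Function.Injective (S.f i) := (f_strictMono hi).injective

lemma f_mem_E {i : ℕ} (hi : S.In i) {x : ℝ} (hx : x ∈ S.E) : S.f i x ∈ S.E := by
  rw [S.hEinv]
  simp only [Set.mem_iUnion]
  exact ⟨i, Finset.mem_Icc.2 hi, x, hx, rfl⟩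

lemma a_mem : S.a ∈ S.E := S.hEcpt.sInf_mem S.hEne
lemma b_mem : S.b ∈ S.E := S.hEcpt.sSup_mem S.hEne

lemma E_sub_I {x : ℝ} (hx : x ∈ S.E) : x ∈ S.I :=
  ⟨csInf_le S.hEcpt.bddBelow hx, le_csSup S.hEcpt.bddAbove hx⟩

lemma f_mem_I {i : ℕ} (hi : S.In i) {x : ℝ} (hx : x ∈ S.I) : S.f i x ∈ S.I :=
  ⟨(E_sub_I (f_mem_E hi a_mem)).1.trans ((f_strictMono hi).monotone hx.1),
   ((f_strictMono hi).monotone hx.2).trans (E_sub_I (f_mem_E hi b_mem)).2⟩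

lemma iter_mem_I {i : ℕ} (hi : S.In i) {x : ℝ} (hx : x ∈ S.I) (u : ℕ) : (S.f i)^[u] x ∈ S.I := by
  induction u with
  | zero => exact hx
  | succ u ih => rw [Function.iterate_succ_apply']; exact f_mem_I hi ih

lemma prefix_add (d : ℕ → ℕ) (n k : ℕ) (y : ℝ) :
    S.prefixMap d (n + k) y = S.prefixMap d n (S.prefixMap (fun j => d (n + j)) k y) := by
  induction k generalizing y with
  | zero => rfl
  | succ k ih => exact ih _

lemma prefix_congr {d e : ℕ → ℕ} (n : ℕ) (h : ∀ k < n, d k = e k) :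
    S.prefixMap d n = S.prefixMap e n := by
  induction n with
  | zero => rfl
  | succ n ih =>
    simp only [prefixMap]
    rw [ih (fun k hk => h k (by omega)), h n (by omega)]

lemma prefix_const {d : ℕ → ℕ} {i : ℕ} (n : ℕ) (h : ∀ k < n, d k = i) :
    S.prefixMap d n = (S.f i)^[n] := by
  induction n with
  | zero => rfl
  | succ n ih =>
    simp only [prefixMap]
    rw [ih (fun k hk => h k (by omega)), h n (by omega), Function.iterate_succ]

lemma exists_rho (S : ClassE) : ∃ ρ : ℝ, 0 ≤ ρ ∧ ρ < 1 ∧ ∀ i, S.In i → S.r i ≤ ρ := by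
  have hm := S.hm
  have hne : (Finset.Icc 1 S.m).Nonempty := ⟨1, by simp; omega⟩
  obtain ⟨j, hj, hmax⟩ := Finset.exists_max_image (Finset.Icc 1 S.m) S.r hne
  rw [Finset.mem_Icc] at hj
  have := S.hr j hj.1 hj.2
  exact ⟨S.r j, this.1.le, this.2, fun i hi => hmax i (Finset.mem_Icc.2 hi)⟩

lemma prefix_affine {ρ : ℝ} (h0 : 0 ≤ ρ) (hρ : ∀ i, S.In i → S.r i ≤ ρ) (d : ℕ → ℕ) (n : ℕ)
    (hd : ∀ k < n, S.In (d k)) :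
    ∃ c t : ℝ, 0 < c ∧ c ≤ ρ ^ n ∧ ∀ x, S.prefixMap d n x = c * x + t := by
  induction n with
  | zero => exact ⟨1, 0, by simp, by simp, fun x => by simp [prefixMap]⟩
  | succ n ih =>
    obtain ⟨c, t, hc, hc', h⟩ := ih (fun k hk => hd k (by omega))
    have hi := hd n (by omega)
    have hr := S.hr _ hi.1 hi.2
    refine ⟨c * S.r (d n), c * S.t (d n) + t, mul_pos hc hr.1, ?_, fun x => ?_⟩
    · rw [pow_succ]
      exact mul_le_mul hc' (hρ _ hi) hr.1.le (by positivity)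
    · simp only [prefixMap, Function.comp, h, f]; ring

lemma prefix_mem_I {d : ℕ → ℕ} (n : ℕ) (hd : ∀ k < n, S.In (d k)) {x : ℝ} (hx : x ∈ S.I) :
    S.prefixMap d n x ∈ S.I := by
  induction n generalizing x with
  | zero => exact hx
  | succ n ih =>
    exact ih (fun k hk => hd k (by omega)) (f_mem_I (hd n (by omega)) hx)

lemma prefix_mem_E {d : ℕ → ℕ} (n : ℕ) (hd : ∀ k < n, S.In (d k)) {x : ℝ} (hx : x ∈ S.E) :
    S.prefixMap d n x ∈ S.E := by
  induction n generalizing x with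
  | zero => exact hx
  | succ n ih =>
    exact ih (fun k hk => hd k (by omega)) (f_mem_E (hd n (by omega)) hx)

lemma prefix_bound {ρ : ℝ} (h0 : 0 ≤ ρ) (hρ : ∀ i, S.In i → S.r i ≤ ρ) (d : ℕ → ℕ) (n : ℕ)
    (hd : ∀ k < n, S.In (d k)) {y : ℝ} (hy : y ∈ S.I) :
    |S.prefixMap d n 0 - S.prefixMap d n y| ≤ ρ ^ n * max |S.a| |S.b| := by
  obtain ⟨c, t, hc, hc', h⟩ := prefix_affine h0 hρ d n hd
  rw [h, h]
  have : c * 0 + t - (c * y + t) = - (c * y) := by ring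
  rw [this, abs_neg, abs_mul, abs_of_pos hc]
  exact mul_le_mul hc' (abs_le_max_abs_abs hy.1 hy.2) (abs_nonneg _) (by positivity)

lemma tendsto_bound {ρ C : ℝ} (h0 : 0 ≤ ρ) (h1 : ρ < 1) :
    Tendsto (fun n : ℕ => ρ ^ n * C) atTop (nhds 0) := by
  simpa using (tendsto_pow_atTop_nhds_zero_of_lt_one h0 h1).mul_const C

lemma coding_of_crit {d : ℕ → ℕ} {x : ℝ} (hd : ∀ n, S.In (d n))
    (h : ∀ n, ∃ y ∈ S.I, S.prefixMap d n y = x) : S.isCoding d x := by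
  refine ⟨hd, ?_⟩
  obtain ⟨ρ, h0, h1, hρ⟩ := exists_rho S
  rw [tendsto_iff_dist_tendsto_zero]
  refine squeeze_zero (fun _ => dist_nonneg) (fun n => ?_)
    (tendsto_bound (C := max |S.a| |S.b|) h0 h1)
  obtain ⟨y, hy, hyx⟩ := h n
  rw [Real.dist_eq, ← hyx]
  exact prefix_bound h0 hρ d n (fun k _ => hd k) hy

lemma coding_mem_E {d : ℕ → ℕ} {x : ℝ} (h : S.isCoding d x) : x ∈ S.E := by
  obtain ⟨ρ, h0, h1, hρ⟩ := exists_rho S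
  have key : Tendsto (fun n => S.prefixMap d n S.a) atTop (nhds x) := by
    have h2 : Tendsto (fun n => S.prefixMap d n 0 - S.prefixMap d n S.a) atTop (nhds 0) := by
      rw [tendsto_zero_iff_abs_tendsto_zero]
      exact squeeze_zero (fun _ => abs_nonneg _)
        (fun n => prefix_bound h0 hρ d n (fun k _ => h.1 k) (E_sub_I a_mem))
        (tendsto_bound (C := max |S.a| |S.b|) h0 h1)
    simpa using h.2.sub h2
  exact S.hEcpt.isClosed.mem_of_tendsto key
    (Eventually.of_forall fun n => prefix_mem_E n (fun k _ => h.1 k) a_mem)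

lemma coding_of_shift {d : ℕ → ℕ} {n : ℕ} {y : ℝ} (hd : ∀ k < n, S.In (d k))
    (h : S.isCoding (fun k => d (n + k)) y) : S.isCoding d (S.prefixMap d n y) := by
  obtain ⟨ρ, h0, h1, hρ⟩ := exists_rho S
  obtain ⟨c, t, hc, -, hct⟩ := prefix_affine h0 hρ d n hd
  refine ⟨fun k => ?_, ?_⟩
  · by_cases hk : k < n
    · exact hd k hk
    · have := h.1 (k - n)
      simpa [Nat.add_sub_of_le (not_lt.1 hk)] using this
  · rw [← tendsto_add_atTop_iff_nat n]
    have : (fun k => S.prefixMap d (k + n) 0) =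
        fun k => c * S.prefixMap (fun j => d (n + j)) k 0 + t := by
      funext k; rw [add_comm k n, prefix_add, hct]
    rw [this, hct]
    exact (h.2.const_mul c).add_const t

lemma coding_shift {d : ℕ → ℕ} {x : ℝ} (n : ℕ) (h : S.isCoding d x) :
    ∃ y, S.isCoding (fun k => d (n + k)) y ∧ S.prefixMap d n y = x := by
  obtain ⟨ρ, h0, h1, hρ⟩ := exists_rho S
  obtain ⟨c, t, hc, -, hct⟩ := prefix_affine h0 hρ d n (fun k _ => h.1 k)
  refine ⟨(x - t) / c, ⟨fun k => h.1 _, ?_⟩, ?_⟩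
  · have h2 := (tendsto_add_atTop_iff_nat n).2 h.2
    have : (fun k => S.prefixMap (fun j => d (n + j)) k 0) =
        fun k => (S.prefixMap d (k + n) 0 - t) / c := by
      funext k; rw [add_comm k n, prefix_add, hct]; field_simp; ring
    rw [this]
    exact (h2.sub_const t).div_const c
  · rw [hct]; field_simp; ring

lemma coding_head {d : ℕ → ℕ} {x : ℝ} (h : S.isCoding d x) :
    ∃ y, S.isCoding (fun k => d (k + 1)) y ∧ S.f (d 0) y = x := by
  obtain ⟨y, hy, hyx⟩ := coding_shift 1 h
  refine ⟨y, ?_, hyx⟩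
  simpa [add_comm] using hy

lemma coding_cons {d : ℕ → ℕ} {y : ℝ} (h0 : S.In (d 0))
    (h : S.isCoding (fun k => d (k + 1)) y) : S.isCoding d (S.f (d 0) y) := by
  have := coding_of_shift (S := S) (d := d) (n := 1) (y := y)
    (fun k hk => by obtain rfl : k = 0 := by omega
                    exact h0) (by simpa [add_comm] using h)
  exact this

lemma coding_of_eq_closure {x : ℝ} {e : ℕ → ℕ}
    (h : ∀ n, ∃ e', S.isCoding e' x ∧ ∀ k < n, e' k = e k) : S.isCoding e x := by
  apply coding_of_crit
  · intro n
    obtain ⟨e', h1, h2⟩ := h (n + 1)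
    rw [← h2 n (by omega)]; exact h1.1 n
  · intro n
    obtain ⟨e', h1, h2⟩ := h n
    obtain ⟨y, hy, hyx⟩ := coding_shift n h1
    exact ⟨y, E_sub_I (coding_mem_E hy), by rw [← prefix_congr n h2]; exact hyx⟩

/-- A dense-in-itself family of codings gives uncountably many codings. -/
lemma uncountable_of_family {x : ℝ} (K : Set (ℕ → ℕ)) (hK : K ⊆ S.codings x) (hne : K.Nonempty)
    (hacc : ∀ e ∈ K, ∀ n, ∃ e' ∈ K, e' ≠ e ∧ ∀ k < n, e' k = e k) :
    ¬ (S.codings x).Countable := by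
  intro hc
  have hnh : ∀ (e : ℕ → ℕ) (V : Set (ℕ → ℕ)), V ∈ nhds e →
      ∃ n, ∀ e', (∀ k < n, e' k = e k) → e' ∈ V := by
    intro e V hV
    rw [nhds_pi, Filter.mem_pi] at hV
    obtain ⟨J, hJ, t, ht, hsub⟩ := hV
    obtain ⟨n, hn⟩ := hJ.bddAbove
    refine ⟨n + 1, fun e' he' => hsub fun i hi => ?_⟩
    rw [he' i (by have := hn hi; omega)]
    exact mem_of_mem_nhds (ht i)
  have hpre : Preperfect K := by
    intro e he
    rw [accPt_iff_nhds]
    intro V hV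
    obtain ⟨n, hn⟩ := hnh e V hV
    obtain ⟨e', h1, h2, h3⟩ := hacc e he n
    exact ⟨e', ⟨hn e' h3, h1⟩, h2⟩
  have hperf := hpre.perfect_closure
  let _ := TopologicalSpace.upgradeIsCompletelyMetrizable (ℕ → ℕ)
  obtain ⟨g, hg, -, hginj⟩ := hperf.exists_nat_bool_injection hne.closure
  have hcl : closure K ⊆ S.codings x := by
    intro e he
    apply coding_of_eq_closure
    intro n
    rw [mem_closure_iff_nhds] at he
    have hV : {e' : ℕ → ℕ | ∀ k < n, e' k = e k} ∈ nhds e := by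
      have : {e' : ℕ → ℕ | ∀ k < n, e' k = e k} =
          ⋂ k ∈ Finset.range n, {e' : ℕ → ℕ | e' k = e k} := by
        ext; simp
      rw [this, Filter.biInter_finset_mem]
      intro k _
      have hcont : Continuous (fun e' : ℕ → ℕ => e' k) := continuous_apply k
      exact ((isOpen_discrete ({e k} : Set ℕ)).preimage hcont).mem_nhds rfl
    obtain ⟨e', h1, h2⟩ := he _ hV
    exact ⟨e', hK h2, h1⟩
  have h1 : (range g).Countable := hc.mono (hg.trans hcl)
  have h3 : Uncountable (ℕ → Bool) := by
    rw [← Cardinal.aleph0_lt_mk_iff]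
    simpa using Cardinal.cantor Cardinal.aleph0
  have h2 : Countable (ℕ → Bool) := by
    rw [← Set.image_univ] at h1
    have := Set.countable_of_injective_of_countable_image hginj.injOn h1
    exact Set.countable_univ_iff.1 this
  exact not_countable h2

end ClassE
namespace ClassE

variable {S : ClassE}

structure Ov (S : ClassE) (M L i j u v : ℕ) : Prop where
  hu : 1 ≤ u
  hv : 1 ≤ v
  eq : ∀ x, S.f i ((S.f M)^[u] x) = S.f j ((S.f L)^[v] x)
  img : ∀ y ∈ S.I, S.f i y ∈ S.f j '' S.I → y ∈ (S.f M)^[u] '' S.I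

lemma comp_affine {i M : ℕ} (hi : S.In i) (hM : S.In M) (u : ℕ) :
    ∃ c t : ℝ, 0 < c ∧ ∀ x, S.f i ((S.f M)^[u] x) = c * x + t := by
  induction u with
  | zero => exact ⟨S.r i, S.t i, (S.hr i hi.1 hi.2).1, fun x => rfl⟩
  | succ u ih =>
    obtain ⟨c, t, hc, h⟩ := ih
    refine ⟨c * S.r M, c * S.t M + t, mul_pos hc (S.hr M hM.1 hM.2).1, fun x => ?_⟩
    rw [Function.iterate_succ_apply, h]; unfold f; ring

lemma one_In : S.In 1 := ⟨le_rfl, by have := S.hm; omega⟩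
lemma m_In : S.In S.m := ⟨by have := S.hm; omega, le_rfl⟩

lemma a_lt_b (hS : S.goodE) : S.a < S.b :=
  (f_strictMono m_In).lt_iff_lt.1 hS.1.2.2.1

lemma affine_image {g : ℝ → ℝ} {c t : ℝ} (hc : 0 < c) (h : ∀ x, g x = c * x + t) :
    g '' S.I = Set.Icc (g S.a) (g S.b) := by
  have : g = fun x => c * x + t := funext h
  subst this
  unfold I
  exact Set.image_affine_Icc' hc t S.a S.b

lemma eq_of_image_eq (hab : S.a < S.b) {g g' : ℝ → ℝ} {c t c' t' : ℝ} (hc : 0 < c) (h : ∀ x, g x = c * x + t)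
    (hc' : 0 < c') (h' : ∀ x, g' x = c' * x + t') (he : g '' S.I = g' '' S.I) (x : ℝ) : g x = g' x := by
  rw [affine_image hc h, affine_image hc' h'] at he
  have h1 : g S.a ≤ g S.b := by rw [h, h]; nlinarith
  have h2 := (Set.Icc_eq_Icc_iff h1).1 he
  obtain ⟨e1, e2⟩ := h2
  rw [h, h'] at e1 e2
  have : (c - c') * (S.b - S.a) = 0 := by linarith
  have : c = c' := by
    rcases mul_eq_zero.1 this with h | h <;> linarith
  subst this
  rw [h, h']; linarith

lemma f_a_lt (hS : S.goodE) {i j : ℕ} (hi : 1 ≤ i) (hij : i < j) (hj : j ≤ S.m) :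
    S.f i S.a < S.f j S.a := by
  induction j, hij using Nat.le_induction with
  | base => exact hS.1.2.1 i hi (by omega)
  | succ n hn ih => exact (ih (by omega)).trans (hS.1.2.1 n (by omega) (by omega))

lemma f_image {i : ℕ} (hi : S.In i) : S.f i '' S.I = Set.Icc (S.f i S.a) (S.f i S.b) :=
  affine_image (t := S.t i) (S.hr i hi.1 hi.2).1 (fun _ => rfl)

lemma far (hS : S.goodE) {i j : ℕ} (hi : 1 ≤ i) (hij : i + 2 ≤ j) (hj : j ≤ S.m) {y : ℝ}
    (h1 : y ∈ S.f i '' S.I) (h2 : y ∈ S.f j '' S.I) : False := by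
  have hab := a_lt_b hS
  have hB := hS.2.1 i hi (by omega)
  rw [f_image ⟨hi, by omega⟩] at h1 hB
  rw [f_image ⟨by omega, hj⟩] at h2
  rw [f_image ⟨by omega, by omega⟩] at hB
  have h3 : S.f i S.b < S.f (i + 2) S.a := by
    by_contra hcon
    push Not at hcon
    have : S.f (i + 2) S.a ∈ (∅ : Set ℝ) := by
      rw [← hB]
      refine ⟨⟨(f_a_lt hS hi (by omega) (by omega)).le, hcon⟩, le_rfl, ?_⟩
      exact ((f_strictMono ⟨by omega, by omega⟩).monotone hab.le)
    exact this
  have h4 : S.f (i + 2) S.a ≤ S.f j S.a := by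
    rcases Nat.lt_or_ge (i + 2) j with h | h
    · exact (f_a_lt hS (by omega) h hj).le
    · obtain rfl : j = i + 2 := by omega
      exact le_rfl
  linarith [h1.2, h2.1]

lemma ov_lt (hS : S.goodE) {i j : ℕ} (hi : S.In i) (hj : S.In j) (hij : i < j) {y : ℝ}
    (h1 : y ∈ S.f i '' S.I) (h2 : y ∈ S.f j '' S.I) :
    j = i + 1 ∧ ∃ u v, Ov S S.m 1 i j u v ∧ Ov S 1 S.m j i v u := by
  have hji : j = i + 1 := by
    by_contra hne
    exact far hS hi.1 (by omega) hj.2 h1 h2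
  subst hji
  refine ⟨rfl, ?_⟩
  have hne : S.f i '' S.I ∩ S.f (i + 1) '' S.I ≠ ∅ := by
    intro h
    have : y ∈ (∅ : Set ℝ) := h ▸ ⟨h1, h2⟩
    exact this
  obtain ⟨u, v, hu, hv, e1, e2⟩ := hS.2.2.2 i hi.1 hj.2 hne
  obtain ⟨c, t, hc, hct⟩ := comp_affine hi (m_In (S := S)) u
  obtain ⟨c', t', hc', hct'⟩ := comp_affine hj (one_In (S := S)) v
  have heq := eq_of_image_eq (a_lt_b hS) (g := S.f i ∘ (S.f S.m)^[u])
    (g' := S.f (i + 1) ∘ (S.f 1)^[v]) hc hct hc' hct' (e1.symm.trans e2)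
  refine ⟨u, v, ⟨hu, hv, heq, ?_⟩, ⟨hv, hu, fun x => (heq x).symm, ?_⟩⟩
  · intro y hy hy2
    have : S.f i y ∈ (S.f i ∘ (S.f S.m)^[u]) '' S.I := e1 ▸ ⟨⟨y, hy, rfl⟩, hy2⟩
    obtain ⟨z, hz, hzy⟩ := this
    exact ⟨z, hz, f_inj hi hzy⟩
  · intro y hy hy2
    have : S.f (i + 1) y ∈ (S.f (i + 1) ∘ (S.f 1)^[v]) '' S.I := e2 ▸ ⟨hy2, ⟨y, hy, rfl⟩⟩
    obtain ⟨z, hz, hzy⟩ := this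
    exact ⟨z, hz, f_inj hj hzy⟩

/-- the two sides -/
structure Side (S : ClassE) (M L M' : ℕ) : Prop where
  M_In : S.In M
  L_In : S.In L
  M'_In : S.In M'
  ne : M' ≠ M
  H0 : ∀ y, y ∈ S.f M '' S.I → y ∉ S.f L '' S.I
  H1 : ∀ y j, S.In j → y ∈ S.f M '' S.I → y ∈ S.f j '' S.I → j = M ∨ j = M'
  H2 : ∀ z ∈ S.I, z ∈ S.f M '' S.I → S.f M z ∉ S.f M' '' S.I
  H3 : ∀ y, y ∈ S.f M' '' S.I → y ∈ S.f M '' S.I → ∃ u v, Ov S M L M' M u v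
  gap : ∃ g, S.In g ∧ g ≠ M ∧ ∀ j y, S.In j → j ≠ g → y ∈ S.I → S.f g y ∈ S.f j '' S.I →
    g ≠ L ∧ y ∈ S.f L '' S.I

lemma iter_mem_image {i : ℕ} (hi : S.In i) {u : ℕ} (hu : 1 ≤ u) {y : ℝ}
    (h : y ∈ (S.f i)^[u] '' S.I) : y ∈ S.f i '' S.I := by
  obtain ⟨z, hz, rfl⟩ := h
  obtain ⟨w, rfl⟩ : ∃ w, u = w + 1 := ⟨u - 1, by omega⟩
  rw [Function.iterate_succ_apply']
  exact ⟨_, iter_mem_I hi hz w, rfl⟩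

lemma side_m (hS : S.goodE) : Side S S.m 1 (S.m - 1) := by
  have hm := S.hm
  have hI : S.In (S.m - 1) := ⟨by omega, by omega⟩
  have H0 : ∀ y, y ∈ S.f S.m '' S.I → y ∉ S.f 1 '' S.I :=
    fun y h h' => far hS le_rfl (by omega) le_rfl h' h
  refine ⟨m_In, one_In, hI, by omega, H0, ?_, ?_, ?_, ?_⟩
  · intro y j hj h1 h2
    by_contra hcon
    have := hj.2
    exact far hS hj.1 (by omega) le_rfl h2 h1
  · intro z hz h1 h2
    obtain ⟨-, u, v, -, h⟩ := ov_lt hS hI m_In (by omega) h2 ⟨z, hz, rfl⟩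
    exact H0 z h1 (iter_mem_image one_In h.hu (h.img z hz h2))
  · intro y h1 h2
    obtain ⟨-, u, v, h, -⟩ := ov_lt hS hI m_In (by omega) h1 h2
    exact ⟨u, v, h⟩
  · obtain ⟨⟨i, hi, him, hgap⟩, -⟩ := hS.2.2.1
    have hiI : S.In i := ⟨hi, by omega⟩
    refine ⟨i, hiI, by omega, ?_⟩
    intro j y hj hne hy h
    rcases Nat.lt_or_ge j i with hlt | hge
    · obtain ⟨-, u, v, -, h'⟩ := ov_lt hS hj hiI hlt h ⟨y, hy, rfl⟩
      exact ⟨by have := hj.1; omega, iter_mem_image one_In h'.hu (h'.img y hy h)⟩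
    · exfalso
      obtain ⟨rfl, -⟩ := ov_lt hS hiI hj (by omega) ⟨y, hy, rfl⟩ h
      have : S.f i y ∈ (∅ : Set ℝ) := hgap ▸ ⟨⟨y, hy, rfl⟩, h⟩
      exact this

lemma side_one (hS : S.goodE) : Side S 1 S.m 2 := by
  have hm := S.hm
  have hI : S.In 2 := ⟨by omega, by omega⟩
  have H0 : ∀ y, y ∈ S.f 1 '' S.I → y ∉ S.f S.m '' S.I :=
    fun y h h' => far hS le_rfl (by omega) le_rfl h h'
  refine ⟨one_In, m_In, hI, by omega, H0, ?_, ?_, ?_, ?_⟩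
  · intro y j hj h1 h2
    by_contra hcon
    have := hj.1
    exact far hS le_rfl (by omega) hj.2 h1 h2
  · intro z hz h1 h2
    obtain ⟨-, u, v, h, -⟩ := ov_lt hS one_In hI (by omega) ⟨z, hz, rfl⟩ h2
    exact H0 z h1 (iter_mem_image m_In h.hu (h.img z hz h2))
  · intro y h1 h2
    obtain ⟨-, u, v, -, h⟩ := ov_lt hS one_In hI (by omega) h2 h1
    exact ⟨v, u, h⟩
  · obtain ⟨⟨i, hi, him, hgap⟩, -⟩ := hS.2.2.1
    have hiI : S.In (i + 1) := ⟨by omega, by omega⟩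
    refine ⟨i + 1, hiI, by omega, ?_⟩
    intro j y hj hne hy h
    rcases Nat.lt_or_ge (i + 1) j with hlt | hge
    · obtain ⟨-, u, v, h', -⟩ := ov_lt hS hiI hj hlt ⟨y, hy, rfl⟩ h
      exact ⟨by have := hj.2; omega, iter_mem_image m_In h'.hu (h'.img y hy h)⟩
    · exfalso
      obtain ⟨hj', -⟩ := ov_lt hS hj hiI (by omega) h ⟨y, hy, rfl⟩
      obtain rfl : j = i := by omega
      have : S.f (j + 1) y ∈ (∅ : Set ℝ) := hgap ▸ ⟨h, ⟨y, hy, rfl⟩⟩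
      exact this

lemma ov_ne (hS : S.goodE) {i j : ℕ} (hi : S.In i) (hj : S.In j) (hij : i ≠ j) {y : ℝ}
    (h1 : y ∈ S.f i '' S.I) (h2 : y ∈ S.f j '' S.I) :
    ∃ M L M' u v, Side S M L M' ∧ (M = 1 ∧ L = S.m ∧ M' = 2 ∨ M = S.m ∧ L = 1 ∧ M' = S.m - 1) ∧
      Ov S M L i j u v := by
  rcases Nat.lt_or_ge i j with h | h
  · obtain ⟨-, u, v, h, -⟩ := ov_lt hS hi hj h h1 h2
    exact ⟨_, _, _, u, v, side_m hS, Or.inr ⟨rfl, rfl, rfl⟩, h⟩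
  · obtain ⟨-, u, v, -, h⟩ := ov_lt hS hj hi (by omega) h2 h1
    exact ⟨_, _, _, v, u, side_one hS, Or.inl ⟨rfl, rfl, rfl⟩, h⟩

/-- an orbit: digits `d` and points `x n`, all with infinitely many codings -/
structure Orb (S : ClassE) (d : ℕ → ℕ) (x : ℕ → ℝ) : Prop where
  dIn : ∀ n, S.In (d n)
  step : ∀ n, S.f (d n) (x (n + 1)) = x n
  inf : ∀ n, (S.codings (x n)).Infinite

lemma inf_step {y : ℝ} (h : (S.codings y).Infinite) :
    ∃ i z, S.In i ∧ S.f i z = y ∧ (S.codings z).Infinite := by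
  by_contra hcon
  push Not at hcon
  apply h
  have hsub : S.codings y ⊆ ⋃ i ∈ Finset.Icc 1 S.m,
      (fun (e : ℕ → ℕ) (k : ℕ) => if k = 0 then i else e (k - 1)) ''
        S.codings ((y - S.t i) / S.r i) := by
    intro d hd
    obtain ⟨z, hz, hzy⟩ := coding_head hd
    simp only [Set.mem_iUnion]
    have hr := S.hr (d 0) (hd.1 0).1 (hd.1 0).2
    refine ⟨d 0, Finset.mem_Icc.2 (hd.1 0), fun k => d (k + 1), ?_, ?_⟩
    · have : (y - S.t (d 0)) / S.r (d 0) = z := by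
        rw [← hzy]; unfold f; field_simp [hr.1.ne']; ring
      rw [this]; exact hz
    · funext k
      rcases k with _ | k <;> simp
  refine Set.Finite.subset (Set.Finite.biUnion (Finset.finite_toSet _) ?_) hsub
  intro i hi
  have hi : S.In i := Finset.mem_Icc.1 hi
  have hr := S.hr i hi.1 hi.2
  apply Set.Finite.image
  have hne := hr.1.ne'
  exact hcon i ((y - S.t i) / S.r i) hi (by unfold f; field_simp; ring)

lemma exists_orb {y : ℝ} (h : (S.codings y).Infinite) : ∃ d x, Orb S d x ∧ x 0 = y := by
  choose! D Z h1 h2 h3 using fun y (h : (S.codings y).Infinite) => inf_step h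
  have hx : ∀ n, (S.codings (Z^[n] y)).Infinite := by
    intro n
    induction n with
    | zero => exact h
    | succ n ih => rw [Function.iterate_succ_apply']; exact h3 _ ih
  refine ⟨fun n => D (Z^[n] y), fun n => Z^[n] y, ⟨fun n => h1 _ (hx n), fun n => ?_, hx⟩, rfl⟩
  rw [Function.iterate_succ_apply']; exact h2 _ (hx n)

namespace Orb
variable {d : ℕ → ℕ} {x : ℕ → ℝ}

lemma memE (h : Orb S d x) (n : ℕ) : x n ∈ S.E := by
  obtain ⟨e, he⟩ := (h.inf n).nonempty
  exact coding_mem_E he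

lemma memI (h : Orb S d x) (n : ℕ) : x n ∈ S.I := E_sub_I (h.memE n)

lemma mem_image (h : Orb S d x) (n : ℕ) : x n ∈ S.f (d n) '' S.I :=
  ⟨_, h.memI (n + 1), h.step n⟩

lemma prefix_eq (h : Orb S d x) (n k : ℕ) :
    S.prefixMap (fun j => d (n + j)) k (x (n + k)) = x n := by
  induction k with
  | zero => rfl
  | succ k ih =>
    rw [← ih]
    change S.prefixMap _ k (S.f (d (n + k)) (x (n + k + 1))) = _
    rw [h.step]

lemma coding (h : Orb S d x) (n : ℕ) : S.isCoding (fun j => d (n + j)) (x n) :=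
  coding_of_crit (fun _ => h.dIn _) (fun k => ⟨_, h.memI (n + k), h.prefix_eq n k⟩)

lemma prefix_eq0 (h : Orb S d x) (k : ℕ) : S.prefixMap d k (x k) = x 0 := by
  have := h.prefix_eq 0 k
  simpa using this

lemma coding0 (h : Orb S d x) : S.isCoding d (x 0) := by
  have := h.coding 0
  simpa using this

lemma exists_branch (h : Orb S d x) (N : ℕ) :
    ∃ n ≥ N, ∃ j, S.In j ∧ j ≠ d n ∧ x n ∈ S.f j '' S.I := by
  by_contra hcon
  push Not at hcon
  apply h.inf N
  apply Set.Subsingleton.finite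
  have key : ∀ e ∈ S.codings (x N), ∀ k, S.isCoding (fun j => e (k + j)) (x (N + k)) ∧
      ∀ l < k, e l = d (N + l) := by
    intro e he k
    induction k with
    | zero => exact ⟨by simpa [codings] using he, by simp⟩
    | succ k ih =>
      obtain ⟨z, hz, hzx⟩ := coding_head ih.1
      have hek : e k = d (N + k) := by
        by_contra hne
        exact hcon (N + k) (by omega) (e k) (he.1 k) hne
          ⟨z, E_sub_I (coding_mem_E hz), hzx⟩
      have hz' : z = x (N + (k + 1)) := by
        apply f_inj (h.dIn (N + k))
        rw [← hek]
        change S.f (e k) z = _ at hzx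
        rw [hzx, hek]
        exact (h.step (N + k)).symm
      refine ⟨?_, fun l hl => ?_⟩
      · rw [← hz']
        convert hz using 3
        ring
      · rcases Nat.lt_succ_iff_lt_or_eq.1 hl with h' | rfl
        · exact ih.2 l h'
        · exact hek
  intro e he e' he'
  funext k
  rw [(key e he (k + 1)).2 k (by omega), (key e' he' (k + 1)).2 k (by omega)]

lemma chain (h : Orb S d x) {M L M' : ℕ} (hs : Side S M L M') (u : ℕ) (hu : 1 ≤ u) :
    ∀ n, x n ∈ (S.f M)^[u] '' S.I →
    (∀ k < u, d (n + k) = M) ∨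
      ((∀ k, k + 1 < u → d (n + k) = M) ∧ d (n + (u - 1)) = M' ∧ x (n + (u - 1)) ∈ S.f M '' S.I) := by
  induction u, hu using Nat.le_induction with
  | base =>
    intro n hn
    rcases hs.H1 (x n) (d n) (h.dIn n) hn (h.mem_image n) with h1 | h1
    · left; intro k hk
      obtain rfl : k = 0 := by omega
      exact h1
    · right
      exact ⟨fun k hk => by omega, h1, hn⟩
  | succ u hu ih =>
    rintro n ⟨z, hz, hzx⟩
    rw [Function.iterate_succ_apply'] at hzx
    have hw := iter_mem_image hs.M_In hu ⟨z, hz, rfl⟩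
    have hwI := iter_mem_I hs.M_In hz u
    have hdn : d n = M := by
      rcases hs.H1 (x n) (d n) (h.dIn n) ⟨_, hwI, hzx⟩ (h.mem_image n) with h1 | h1
      · exact h1
      · exfalso
        have := hs.H2 _ hwI hw
        rw [hzx, ← h1] at this
        exact this (h.mem_image n)
    have hx1 : x (n + 1) = (S.f M)^[u] z := by
      apply f_inj hs.M_In
      rw [hzx, ← h.step n, hdn]
    have hpre : ∀ k, d (n + 1 + k) = d (n + (k + 1)) := fun k => by congr 1; omega
    rcases ih (n + 1) ⟨z, hz, hx1.symm⟩ with h1 | ⟨h1, h2, h3⟩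
    · left
      intro k hk
      rcases k with _ | k
      · exact hdn
      · rw [← hpre]; exact h1 k (by omega)
    · right
      have hidx : n + 1 + (u - 1) = n + (u + 1 - 1) := by omega
      rw [hidx] at h2 h3
      refine ⟨fun k hk => ?_, h2, h3⟩
      rcases k with _ | k
      · exact hdn
      · rw [← hpre]; exact h1 k (by omega)

/-- completed branching -/
def Comp (S : ClassE) (d : ℕ → ℕ) (n : ℕ) : Prop :=
  ∃ M L j u v, S.In L ∧ S.In j ∧ j ≠ d n ∧ Ov S M L (d n) j u v ∧ ∀ k < u, d (n + 1 + k) = M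

lemma swap (h : Orb S d x) {n : ℕ} (hc : Comp S d n) :
    ∃ e l n', S.isCoding e (x n) ∧ e 0 ≠ d n ∧ ∀ k, e (l + k) = d (n' + k) := by
  obtain ⟨M, L, j, u, v, hL, hj, hne, hov, hM⟩ := hc
  let e : ℕ → ℕ := fun k => if k = 0 then j else if k < v + 1 then L else d (n + (1 + u) + (k - (v + 1)))
  have htail : ∀ k, e (v + 1 + k) = d (n + (1 + u) + k) := by
    intro k
    have h1 : v + 1 + k ≠ 0 := by omega
    have h2 : ¬ (v + 1 + k < v + 1) := by omega
    simp only [e, if_neg h1, if_neg h2]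
    congr 1; omega
  have he0 : e 0 = j := rfl
  have hmid : ∀ k < v, e (1 + k) = L := by
    intro k hk
    have h1 : 1 + k ≠ 0 := by omega
    have h2 : (1 + k < v + 1) := by omega
    simp only [e, if_neg h1, if_pos h2]
  refine ⟨e, v + 1, n + (1 + u), ?_, by rw [he0]; exact hne, htail⟩
  have hp : S.prefixMap e (v + 1) (x (n + (1 + u))) = x n := by
    rw [add_comm v 1, prefix_add, prefix_const v hmid]
    change S.f (e 0) _ = _
    rw [he0, ← hov.eq, ← h.prefix_eq n (1 + u), prefix_add, prefix_const (i := M) u]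
    · rfl
    · intro k hk
      rw [← hM k hk]; congr 1; omega
  rw [← hp]
  apply coding_of_shift
  · intro k hk
    rcases k with _ | k
    · exact hj
    · rw [add_comm k 1, hmid k (by omega)]; exact hL
  · simp only [htail]
    exact h.coding _

lemma uncountable (h : Orb S d x) (hc : ∀ N, ∃ n ≥ N, Comp S d n) :
    ¬ (S.codings (x 0)).Countable := by
  apply uncountable_of_family {e | S.isCoding e (x 0) ∧ ∃ l n, ∀ k, e (l + k) = d (n + k)}
  · exact fun e he => he.1
  · exact ⟨d, h.coding0, 0, 0, fun _ => rfl⟩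
  · rintro e ⟨he, l, n, hln⟩ N
    obtain ⟨n', hn', hcomp⟩ := hc (n + N)
    obtain ⟨e', l', n'', h1, h2, h3⟩ := h.swap hcomp
    obtain ⟨q, hq⟩ : ∃ q, n' = n + q := ⟨n' - n, by omega⟩
    have hqN : N ≤ q := by omega
    obtain ⟨z, hz, hzx⟩ := coding_shift (l + q) he
    have hz' : z = x n' := by
      have h4 := h.coding n'
      have h5 : (fun k => e (l + q + k)) = fun k => d (n' + k) := by
        funext k
        rw [hq, add_assoc, hln, add_assoc]
      rw [h5] at hz
      exact tendsto_nhds_unique hz.2 h4.2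
    subst hz'
    let E : ℕ → ℕ := fun k => if k < l + q then e k else e' (k - (l + q))
    have hE1 : ∀ k < l + q, E k = e k := fun k hk => by simp only [E, if_pos hk]
    have hE2 : ∀ k, E (l + q + k) = e' k := fun k => by
      have : ¬ (l + q + k < l + q) := by omega
      simp only [E, if_neg this]; congr 1; omega
    refine ⟨E, ⟨?_, l + q + l', n'', fun k => ?_⟩, ?_, fun k hk => hE1 k (by omega)⟩
    · rw [← hzx, ← prefix_congr (l + q) hE1]
      apply coding_of_shift
      · intro k hk; rw [hE1 k hk]; exact he.1 k
      · simp only [hE2]; exact h1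
    · rw [add_assoc, hE2, h3]
    · intro hEe
      have h6 := congrFun hEe (l + q + 0)
      rw [hE2, add_zero, hln, ← hq] at h6
      exact h2 h6

def per (M M' u : ℕ) (k : ℕ) : ℕ := if k % u = 0 then M' else M

lemma key (hS : S.goodE) (h : Orb S d x) (hc : (S.codings (x 0)).Countable) :
    ∃ n M L M' u, Side S M L M' ∧ x n ∈ S.f M '' S.I ∧ ∀ k, d (n + k) = per M M' u k := by
  have hfin : ∃ N, ∀ n ≥ N, ¬ Comp S d n := by
    by_contra hcon
    push Not at hcon
    exact h.uncountable hcon hc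
  obtain ⟨N, hN⟩ := hfin
  obtain ⟨n, hn, j, hj, hne, hmem⟩ := h.exists_branch N
  obtain ⟨M, L, M', u, v, hs, -, hov⟩ := ov_ne hS (h.dIn n) hj hne.symm (h.mem_image n) hmem
  have hgen : ∀ n ≥ N, ∀ j u v, S.In j → j ≠ d n → x n ∈ S.f j '' S.I → Ov S M L (d n) j u v →
      (∀ k, k + 1 < u → d (n + 1 + k) = M) ∧ d (n + u) = M' ∧ x (n + u) ∈ S.f M '' S.I := by
    intro n hn j u v hj hne hmem hov
    have h1 : x (n + 1) ∈ (S.f M)^[u] '' S.I :=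
      hov.img _ (h.memI _) (by rw [h.step]; exact hmem)
    have hu := hov.hu
    have hidx : n + 1 + (u - 1) = n + u := by omega
    rcases h.chain hs u hov.hu (n + 1) h1 with h2 | h2
    · exact absurd ⟨M, L, j, u, v, hs.L_In, hj, hne, hov, h2⟩ (hN n hn)
    · rwa [hidx] at h2
  obtain ⟨-, hd', hx'⟩ := hgen n hn j u v hj hne hmem hov
  set n' := n + u with hn'
  have hn'N : N ≤ n' := by omega
  have hx'' := h.mem_image n'
  rw [hd'] at hx''
  obtain ⟨u₀, v₀, hov₀⟩ := hs.H3 _ hx'' hx'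
  have hiter : ∀ q, d (n' + q * u₀) = M' ∧ x (n' + q * u₀) ∈ S.f M '' S.I ∧
      ∀ k, k + 1 < u₀ → d (n' + q * u₀ + 1 + k) = M := by
    intro q
    have hstep : ∀ p ≥ N, d p = M' → x p ∈ S.f M '' S.I →
        (∀ k, k + 1 < u₀ → d (p + 1 + k) = M) ∧ d (p + u₀) = M' ∧ x (p + u₀) ∈ S.f M '' S.I := by
      intro p hp h1 h2
      refine hgen p hp M u₀ v₀ hs.M_In ?_ h2 ?_
      · rw [h1]; exact hs.ne.symm
      · rw [h1]; exact hov₀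
    induction q with
    | zero =>
      simp only [zero_mul, add_zero]
      exact ⟨hd', hx', (hstep n' hn'N hd' hx').1⟩
    | succ q ih =>
      obtain ⟨h1, h2, h3⟩ := hstep _ (by omega) ih.1 ih.2.1
      have hidx : n' + q * u₀ + u₀ = n' + (q + 1) * u₀ := by ring
      rw [hidx] at h2 h3
      exact ⟨h2, h3, (hstep _ (by omega) h2 h3).1⟩
  refine ⟨n', M, L, M', u₀, hs, hx', fun k => ?_⟩
  have hu₀ := hov₀.hu
  have hk := Nat.div_add_mod k u₀
  have hlt := Nat.mod_lt k hu₀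
  obtain ⟨h1, -, h3⟩ := hiter (k / u₀)
  unfold per
  rw [mul_comm] at hk
  split_ifs with h0
  · rw [← h1]; congr 1; omega
  · rw [← h3 (k % u₀ - 1) (by omega)]; congr 1; omega

end Orb
end ClassE
namespace ClassE

variable {S : ClassE}

lemma mem_U_iff {x : ℝ} : x ∈ S.U Cardinal.aleph0 ↔
    (S.codings x).Infinite ∧ (S.codings x).Countable := by
  constructor
  · rintro ⟨-, h⟩
    refine ⟨?_, ?_⟩
    · rw [← Set.infinite_coe_iff, ← Cardinal.aleph0_le_mk_iff]; exact h.ge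
    · rw [← Cardinal.le_aleph0_iff_set_countable]; exact h.le
  · rintro ⟨h1, h2⟩
    refine ⟨?_, le_antisymm ?_ ?_⟩
    · obtain ⟨e, he⟩ := h1.nonempty
      exact coding_mem_E he
    · rw [Cardinal.le_aleph0_iff_set_countable]; exact h2
    · rw [Cardinal.aleph0_le_mk_iff, Set.infinite_coe_iff]; exact h1

noncomputable def dec (S : ClassE) (p : ℕ × List ℕ × ℕ × ℕ × ℕ) : ℝ :=
  limUnder atTop (fun n => S.prefixMap (fun k =>
    if k < p.1 then p.2.1.getD k 0 else Orb.per p.2.2.1 p.2.2.2.1 p.2.2.2.2 (k - p.1)) n 0)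

lemma U_countable (hS : S.goodE) : (S.U Cardinal.aleph0).Countable := by
  refine (Set.countable_range S.dec).mono ?_
  intro x hx
  obtain ⟨hinf, hcount⟩ := mem_U_iff.1 hx
  obtain ⟨d, X, h, rfl⟩ := exists_orb hinf
  obtain ⟨n, M, L, M', u, -, -, hk⟩ := h.key hS hcount
  refine ⟨(n, (List.range n).map d, M, M', u), ?_⟩
  have : (fun k => if k < n then ((List.range n).map d).getD k 0 else Orb.per M M' u (k - n)) = d := by
    funext k
    split_ifs with hkn
    · simp [hkn]
    · rw [← hk]; congr 1; omega
  unfold dec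
  dsimp only
  rw [this]
  exact h.coding0.2.limUnder_eq

/-- codings of `f g q` when no other cylinder contains it -/
lemma codings_f {g : ℕ} (hg : S.In g) {q : ℝ} (hno : ∀ j, S.In j → j ≠ g → S.f g q ∉ S.f j '' S.I) :
    S.codings (S.f g q) = (fun (e : ℕ → ℕ) (k : ℕ) => if k = 0 then g else e (k - 1)) '' S.codings q := by
  ext d
  constructor
  · intro hd
    obtain ⟨z, hz, hzy⟩ := coding_head hd
    have h0 : d 0 = g := by
      by_contra hne
      exact hno (d 0) (hd.1 0) hne ⟨z, E_sub_I (coding_mem_E hz), hzy⟩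
    have hzq : z = q := by
      rw [h0] at hzy
      exact f_inj hg hzy
    subst hzq
    refine ⟨fun k => d (k + 1), hz, ?_⟩
    funext k
    rcases k with _ | k
    · simp [h0]
    · simp
  · rintro ⟨e, he, rfl⟩
    have := coding_cons (S := S) (d := fun k => if k = 0 then g else e (k - 1)) (y := q)
      (by simpa using hg) (by simpa [codings] using he)
    simpa [codings] using this

lemma cons_inj (g : ℕ) : Function.Injective
    (fun (e : ℕ → ℕ) (k : ℕ) => if k = 0 then g else e (k - 1)) := by
  intro e e' h
  funext k
  simpa using congrFun h (k + 1)

lemma U_step {g : ℕ} (hg : S.In g) {q : ℝ} (hno : ∀ j, S.In j → j ≠ g → S.f g q ∉ S.f j '' S.I)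
    (hq : q ∈ S.U Cardinal.aleph0) : S.f g q ∈ S.U Cardinal.aleph0 := by
  rw [mem_U_iff] at hq ⊢
  rw [codings_f hg hno]
  exact ⟨hq.1.image (cons_inj g).injOn, hq.2.image _⟩

lemma U_infinite (hS : S.goodE) {x : ℝ} (hx : x ∈ S.U Cardinal.aleph0) :
    (S.U Cardinal.aleph0).Infinite := by
  obtain ⟨hinf, hcount⟩ := mem_U_iff.1 hx
  obtain ⟨d, X, h, rfl⟩ := exists_orb hinf
  obtain ⟨n, M, L, M', u, hs, hmem, -⟩ := h.key hS hcount
  have hp : X n ∈ S.U Cardinal.aleph0 := by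
    rw [mem_U_iff]
    refine ⟨h.inf n, ?_⟩
    refine Set.MapsTo.countable_of_injOn
      (f := fun (e : ℕ → ℕ) (k : ℕ) => if k < n then d k else e (k - n))
      (t := S.codings (X 0)) ?_ ?_ hcount
    · intro e he
      have h1 : ∀ k < n, (fun (k : ℕ) => if k < n then d k else e (k - n)) k = d k :=
        fun k hk => by simp [hk]
      have h2 := coding_of_shift (S := S) (n := n) (y := X n)
        (d := fun (k : ℕ) => if k < n then d k else e (k - n))
        (fun k hk => by rw [if_pos hk]; exact h.dIn k) (by simpa [codings] using he)
      rw [prefix_congr n h1, h.prefix_eq0] at h2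
      exact h2
    · intro e _ e' _ he
      funext k
      simpa using congrFun he (n + k)
  obtain ⟨g, hg, hgM, hgap⟩ := hs.gap
  have hno : ∀ q ∈ S.I, (g ≠ L → q ∉ S.f L '' S.I) → ∀ j, S.In j → j ≠ g → S.f g q ∉ S.f j '' S.I := by
    intro q hq hqL j hj hne hcon
    obtain ⟨h1, h2⟩ := hgap j q hj hne hq hcon
    exact hqL h1 h2
  have hpL : g ≠ L → X n ∉ S.f L '' S.I := fun _ => hs.H0 _ hmem
  have hall : ∀ k, (S.f g)^[k] (X n) ∈ S.U Cardinal.aleph0 ∧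
      (g ≠ L → (S.f g)^[k] (X n) ∉ S.f L '' S.I) := by
    intro k
    induction k with
    | zero => exact ⟨hp, hpL⟩
    | succ k ih =>
      rw [Function.iterate_succ_apply']
      have h1 := hno _ (E_sub_I ih.1.1) ih.2
      exact ⟨U_step hg h1 ih.1, fun hgL => h1 L hs.L_In hgL.symm⟩
  have hne : S.f g (X n) ≠ X n := by
    intro he
    apply hno _ (h.memI n) hpL M hs.M_In hgM.symm
    rw [he]; exact hmem
  have hinj : Function.Injective (fun k => (S.f g)^[k] (X n)) := by
    rcases lt_or_gt_of_ne hne with h1 | h1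
    · exact ((f_strictMono hg).strictAnti_iterate_of_map_lt h1).injective
    · exact ((f_strictMono hg).strictMono_iterate_of_lt_map h1).injective
  exact Set.infinite_of_injective_forall_mem hinj (fun k => (hall k).1)

end ClassE

theorem stmt4 (S : ClassE) (hS : S.goodE) :
    ((S.U Cardinal.aleph0).Countable ∧ (S.U Cardinal.aleph0).Infinite) ∨
      S.U Cardinal.aleph0 = ∅ := by
  rcases Set.eq_empty_or_nonempty (S.U Cardinal.aleph0) with h | ⟨x, hx⟩
  · exact Or.inr h
  · exact Or.inl ⟨U_countable hS, U_infinite hS hx⟩
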